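/- arXiv:2106.05339 — 6 statements merged into one kernel-verified Lean document; each statement's English description precedes it below -/
import Mathlib

section
/- Let F be a field, let A be an m×n matrix over F of rank m (so m ≤ n), let b ∈ F^m, and let L ⊆ F^n be the (nonempty, (n−m)-dimensional) affine subspace of solutions of A·x = b, with d = n − m. Then L is in general position if and only if every m×m minor of the m×(n+1) augmented matrix (A | b) is nonzero. -/
open scoped Classical

/-- Dimension of (the affine span of) a subset of `Fin n → F`, with `dim ∅ = -1`. -/
noncomputable def affDim (F : Type*) [Field F] {n : ℕ} (S : Set (Fin n → F)) : ℤ :=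
  if S = ∅ then -1 else (Module.finrank F (affineSpan F S).direction : ℤ)

/-- Intersection of coordinate hyperplanes indexed by `I`. -/
def Hset (F : Type*) [Field F] (n : ℕ) (I : Finset (Fin n)) : Set (Fin n → F) :=
  {x | ∀ i ∈ I, x i = 0}

def InGenPos (F : Type*) [Field F] {n : ℕ} (L : Set (Fin n → F)) (d : ℕ) : Prop :=
  ∀ I : Finset (Fin n), I.card ≤ d + 1 →
    affDim F (L ∩ Hset F n I) = (d : ℤ) - I.card

def InGenPosTranslates (F : Type*) [Field F] {n : ℕ} (L : Set (Fin n → F)) (d : ℕ) : Prop :=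
  ∀ I : Finset (Fin n), I.card ≤ d + 1 →
    affDim F (L ∩ Hset F n I) ≤ (d : ℤ) - I.card

def IsAffineOfDim (F : Type*) [Field F] {n : ℕ} (L : Set (Fin n → F)) (d : ℕ) : Prop :=
  (∃ W : AffineSubspace F (Fin n → F), (W : Set (Fin n → F)) = L) ∧ L.Nonempty ∧
    Module.finrank F (affineSpan F L).direction = d

/-- The augmented matrix `(A | b)`, with `b` as its last column. -/
def augmented {F : Type*} {n m : ℕ} (A : Matrix (Fin m) (Fin n) F) (b : Fin m → F) :
    Matrix (Fin m) (Fin (n + 1)) F :=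
  Matrix.of fun i k => if h : (k : ℕ) < n then A i ⟨k, h⟩ else b i

lemma augmented_mulVec {F : Type*} [Field F] {n m : ℕ} (A : Matrix (Fin m) (Fin n) F)
    (b : Fin m → F) (w : Fin (n + 1) → F) :
    (augmented A b).mulVec w =
      A.mulVec (fun i => w i.castSucc) + w (Fin.last n) • b := by
  ext i
  simp [augmented, Matrix.mulVec, dotProduct, Fin.sum_univ_castSucc, mul_comm]

lemma mulVec_eq_submatrix_mulVec {F ι κ σ : Type*} [Field F] [Fintype κ] [Fintype σ]
    (B : Matrix ι κ F) {f : σ → κ} (hf : Function.Injective f) {w : κ → F}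
    (hw : ∀ k ∉ Set.range f, w k = 0) :
    B.mulVec w = (B.submatrix id f).mulVec (w ∘ f) := by
  ext i
  simp only [Matrix.mulVec, dotProduct, Matrix.submatrix_apply, id, Function.comp]
  exact (Finset.sum_of_injOn f hf.injOn (by simp) (fun k _ hk => by simp [hw k (by simpa using hk)]) (fun _ _ => rfl)).symm

/-- All maximal minors of an `m × N` matrix are nonzero iff its kernel contains no nonzero vector
with at least `N - m` zero coordinates. -/
lemma maximal_minors_ne_zero_iff {F : Type*} [Field F] {m e N : ℕ} (hN : m + e = N)
    (B : Matrix (Fin m) (Fin N) F) :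
    (∀ f : Fin m → Fin N, Function.Injective f → (B.submatrix id f).det ≠ 0) ↔
      ∀ w : Fin N → F, B.mulVec w = 0 →
        e ≤ (Finset.univ.filter fun k => w k = 0).card → w = 0 := by
  constructor
  · intro h w hw hcard
    have hsum := Finset.card_filter_add_card_filter_not (s := Finset.univ) (fun k => w k = 0)
    rw [Finset.card_univ, Fintype.card_fin] at hsum
    obtain ⟨T, hT, hTm⟩ := Finset.exists_superset_card_eq
      (s := Finset.univ.filter fun k => ¬ w k = 0) (n := m) (by omega) (by simp; omega)
    have hsupp : ∀ k ∉ Set.range (T.orderEmbOfFin hTm), w k = 0 := by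
      intro k hk
      by_contra hne
      exact hk (by simpa using hT (by simpa using hne))
    have hinj := (T.orderEmbOfFin hTm).injective
    rw [mulVec_eq_submatrix_mulVec B hinj hsupp] at hw
    have hzero := Matrix.eq_zero_of_mulVec_eq_zero (h _ hinj) hw
    ext k
    by_cases hk : k ∈ Set.range (T.orderEmbOfFin hTm)
    · obtain ⟨j, rfl⟩ := hk
      exact congrFun hzero j
    · exact hsupp k hk
  · intro h f hf hdet
    obtain ⟨v, hv, hBv⟩ := Matrix.exists_mulVec_eq_zero_iff.mpr hdet
    have hcomp : Function.extend f v (0 : Fin N → F) ∘ f = v :=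
      funext fun j => hf.extend_apply v 0 j
    have hsupp : ∀ k ∉ Set.range f, Function.extend f v (0 : Fin N → F) k = 0 := fun k hk =>
      Function.extend_apply' v (0 : Fin N → F) k hk
    have hw := h (Function.extend f v (0 : Fin N → F))
      (by rw [mulVec_eq_submatrix_mulVec B hf hsupp, hcomp, hBv]) (by
        have hle : ((Finset.univ.image f)ᶜ).card ≤
            (Finset.univ.filter fun k => Function.extend f v (0 : Fin N → F) k = 0).card :=
          Finset.card_le_card fun k hk => by
            simp only [Finset.mem_filter, Finset.mem_univ, true_and]
            exact hsupp k (by simpa using hk)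
        rw [Finset.card_compl, Finset.card_image_of_injective _ hf] at hle
        simp only [Finset.card_univ, Fintype.card_fin] at hle
        omega)
    exact hv (by rw [← hcomp, hw]; rfl)

lemma card_zeros_fin_succ {F : Type*} [Field F] {n : ℕ} (w : Fin (n + 1) → F) :
    (Finset.univ.filter fun k => w k = 0).card =
      (Finset.univ.filter fun i : Fin n => w i.castSucc = 0).card +
        if w (Fin.last n) = 0 then 1 else 0 := by
  simp only [Finset.card_filter, Fin.sum_univ_castSucc]

/-- The linear map sending `x` to `(A x, x|_I)`. -/
def mulVecProdRestrict {F : Type*} [Field F] {n m : ℕ} (A : Matrix (Fin m) (Fin n) F)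
    (I : Finset (Fin n)) : (Fin n → F) →ₗ[F] (Fin m → F) × (I → F) :=
  A.mulVecLin.prod (LinearMap.funLeft F F Subtype.val)

lemma mulVecProdRestrict_eq_iff {F : Type*} [Field F] {n m : ℕ} (A : Matrix (Fin m) (Fin n) F)
    (I : Finset (Fin n)) (x : Fin n → F) (b : Fin m → F) :
    mulVecProdRestrict A I x = (b, 0) ↔ x ∈ {x | A.mulVec x = b} ∩ Hset F n I := by
  simp [mulVecProdRestrict, Hset, funext_iff, LinearMap.funLeft_apply]

lemma affDim_eq_neg_one_iff {F : Type*} [Field F] {n : ℕ} (S : Set (Fin n → F)) :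
    affDim F S = -1 ↔ S = ∅ := by
  unfold affDim
  split_ifs with h
  · simp [h]
  · refine iff_of_false (fun h' => ?_) h
    omega

lemma affDim_eq_finrank_ker {F : Type*} [Field F] {n m : ℕ} (A : Matrix (Fin m) (Fin n) F)
    (b : Fin m → F) (I : Finset (Fin n))
    (hne : ({x | A.mulVec x = b} ∩ Hset F n I).Nonempty) :
    affDim F ({x | A.mulVec x = b} ∩ Hset F n I) =
      Module.finrank F (LinearMap.ker (mulVecProdRestrict A I)) := by
  obtain ⟨p, hp⟩ := hne
  have hS : {x | A.mulVec x = b} ∩ Hset F n I =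
      (AffineSubspace.mk' p (LinearMap.ker (mulVecProdRestrict A I)) : Set (Fin n → F)) := by
    ext x
    rw [SetLike.mem_coe, AffineSubspace.mem_mk', vsub_eq_sub, LinearMap.mem_ker, map_sub,
      sub_eq_zero, (mulVecProdRestrict_eq_iff A I p b).mpr hp, mulVecProdRestrict_eq_iff]
  rw [affDim, if_neg (Set.nonempty_iff_ne_empty.mp ⟨p, hp⟩), hS, AffineSubspace.affineSpan_coe,
    AffineSubspace.direction_mk']

lemma inGenPos_iff_augmented_ker {F : Type*} [Field F] {n m d : ℕ} (hmd : m + d = n)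
    (A : Matrix (Fin m) (Fin n) F) (b : Fin m → F) :
    InGenPos F {x | A.mulVec x = b} d ↔
      ∀ w : Fin (n + 1) → F, (augmented A b).mulVec w = 0 →
        d + 1 ≤ (Finset.univ.filter fun k => w k = 0).card → w = 0 := by
  constructor
  · intro h w hw hcard
    rw [augmented_mulVec] at hw
    rw [card_zeros_fin_succ] at hcard
    by_cases ht : w (Fin.last n) = 0
    · rw [if_pos ht] at hcard
      obtain ⟨I, hI, hId⟩ := Finset.exists_subset_card_eq (Nat.le_of_succ_le_succ hcard)
      have hdim := h I (by omega)
      have hne : ({x | A.mulVec x = b} ∩ Hset F n I).Nonempty := by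
        rw [Set.nonempty_iff_ne_empty, Ne, ← affDim_eq_neg_one_iff]
        omega
      rw [affDim_eq_finrank_ker A b I hne, hId, sub_self, Nat.cast_eq_zero,
        Submodule.finrank_eq_zero] at hdim
      have hmem : (fun i : Fin n => w i.castSucc) ∈ LinearMap.ker (mulVecProdRestrict A I) := by
        rw [LinearMap.mem_ker]
        refine (mulVecProdRestrict_eq_iff A I _ 0).mpr ⟨by simpa [ht] using hw, fun i hi => ?_⟩
        simpa using hI hi
      rw [hdim, Submodule.mem_bot] at hmem
      ext k
      exact Fin.lastCases ht (fun i => congrFun hmem i) k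
    · rw [if_neg ht, add_zero] at hcard
      obtain ⟨I, hI, hId⟩ := Finset.exists_subset_card_eq hcard
      have hdim := h I hId.le
      have hempty := (affDim_eq_neg_one_iff _).mp (hdim.trans (by rw [hId]; push_cast; ring))
      refine absurd hempty (Set.nonempty_iff_ne_empty.mp
        ⟨-(w (Fin.last n))⁻¹ • fun i : Fin n => w i.castSucc, ?_, fun i hi => ?_⟩)
      · rw [Set.mem_ofPred_eq, Matrix.mulVec_smul, eq_neg_of_add_eq_zero_left hw, smul_neg,
          neg_smul, neg_neg, inv_smul_smul₀ ht]
      · have hi0 : w i.castSucc = 0 := by simpa using hI hi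
        simp [hi0]
  · intro h I hI
    have key : ∀ (x : Fin n → F) (t : F) (J : Finset (Fin n)), x ∈ Hset F n J →
        A.mulVec x = t • b → d + 1 ≤ J.card + (if t = 0 then 1 else 0) → x = 0 ∧ t = 0 := by
      intro x t J hx hAx hJ
      have hw := h (Fin.snoc x (-t)) (by simp [augmented_mulVec, hAx]) (by
        rw [card_zeros_fin_succ]
        simp only [Fin.snoc_castSucc, Fin.snoc_last, neg_eq_zero]
        refine hJ.trans (Nat.add_le_add_right (Finset.card_le_card fun i hi => ?_) _)
        simpa using hx i hi)
      refine ⟨funext fun i => ?_, ?_⟩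
      · simpa using congrFun hw i.castSucc
      · simpa using congrFun hw (Fin.last n)
    rcases hI.eq_or_lt with hId | hId
    · rw [hId]
      push_cast
      rw [sub_add_cancel_left, affDim_eq_neg_one_iff, Set.eq_empty_iff_forall_notMem]
      rintro x ⟨hx, hxI⟩
      exact one_ne_zero (key x 1 I hxI (by simpa using hx) (by omega)).2
    · obtain ⟨J, hIJ, hJd⟩ := Finset.exists_superset_card_eq (s := I) (n := d) (by omega)
        (by simp; omega)
      have hinj : Function.Injective (mulVecProdRestrict A J) := by
        rw [injective_iff_map_eq_zero]
        intro x hx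
        obtain ⟨hAx, hxJ⟩ := (mulVecProdRestrict_eq_iff A J x 0).mp hx
        exact (key x 0 J hxJ (by simpa using hAx) (by simp [hJd])).1
      have hsurjJ : Function.Surjective (mulVecProdRestrict A J) :=
        (LinearMap.injective_iff_surjective_of_finrank_eq_finrank (by simp; omega)).mp hinj
      have hsurj : Function.Surjective (mulVecProdRestrict A I) := by
        rintro ⟨c, y⟩
        obtain ⟨x, hx⟩ := hsurjJ (c, fun j => if hj : (j : Fin n) ∈ I then y ⟨j, hj⟩ else 0)
        refine ⟨x, Prod.ext (show _ = c from congrArg Prod.fst hx) (funext fun i => ?_)⟩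
        have hxi := congrFun (congrArg Prod.snd hx) ⟨i, hIJ i.2⟩
        simpa [mulVecProdRestrict, LinearMap.funLeft_apply] using hxi
      obtain ⟨p, hp⟩ := hsurj (b, 0)
      rw [affDim_eq_finrank_ker A b I ⟨p, (mulVecProdRestrict_eq_iff A I p b).mp hp⟩]
      have hrk := LinearMap.finrank_range_add_finrank_ker (mulVecProdRestrict A I)
      rw [LinearMap.range_eq_top.mpr hsurj, finrank_top] at hrk
      simp at hrk
      omega

/-- The solution set of `A·x = b` (with `A` of maximal rank `m = n - d`) is in general position
iff every `m×m` minor of the augmented matrix `(A | b)` is nonzero. -/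
theorem genPos_iff_minors {F : Type*} [Field F] {n m d : ℕ} (hmd : m + d = n)
    (A : Matrix (Fin m) (Fin n) F) (b : Fin m → F) (hrank : A.rank = m) :
    InGenPos F {x | A.mulVec x = b} d ↔
      ∀ f : Fin m → Fin (n + 1), Function.Injective f →
        (Matrix.of fun i j : Fin m =>
          if h : ((f j : ℕ) < n) then A i ⟨(f j : ℕ), h⟩ else b i).det ≠ 0 := by
  rw [inGenPos_iff_augmented_ker hmd,
    ← maximal_minors_ne_zero_iff (e := d + 1) (by omega) (augmented A b)]
  rfl
end

section
/- Let F be a field, let A be an m×n matrix over F of rank m with columns a_1,…,a_n ∈ F^m, let b ∈ F^m, and let L ⊆ F^n be the (n−m)-dimensional affine subspace of solutions of A·x = b, with d = n − m. Then L is in general position among its translates if and only if b does not lie in any proper linear subspace of F^m spanned by a subset of the columns of A; that is, if and only if for every subset J ⊆ {1,…,n}, b ∈ span{a_j : j ∈ J} implies span{a_j : j ∈ J} = F^m. -/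
open scoped Classical

/-- The subspace of vectors vanishing on `I`. -/
def vanishingOn (F : Type*) [Field F] {n : ℕ} (I : Finset (Fin n)) :
    Submodule F (Fin n → F) :=
  LinearMap.ker (LinearMap.funLeft F F ((↑) : I → Fin n))

theorem mem_vanishingOn {F : Type*} [Field F] {n : ℕ} {I : Finset (Fin n)} {x : Fin n → F} :
    x ∈ vanishingOn F I ↔ ∀ i ∈ I, x i = 0 := by
  simp [vanishingOn, LinearMap.mem_ker, funext_iff, LinearMap.funLeft_apply]

theorem card_add_finrank_vanishingOn {F : Type*} [Field F] {n : ℕ} (I : Finset (Fin n)) :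
    I.card + Module.finrank F (vanishingOn F I) = n := by
  have h := (LinearMap.funLeft F F ((↑) : I → Fin n)).finrank_range_add_finrank_ker
  rw [LinearMap.range_eq_top.2
    (LinearMap.funLeft_surjective_of_injective F F _ Subtype.val_injective), finrank_top,
    Module.finrank_fintype_fun_eq_card, Module.finrank_fin_fun, Fintype.card_coe] at h
  exact h

theorem map_vanishingOn {F : Type*} [Field F] {n m : ℕ} (A : Matrix (Fin m) (Fin n) F)
    (I : Finset (Fin n)) :
    (vanishingOn F I).map A.mulVecLin =
      Submodule.span F ((fun j i => A i j) '' (I : Set (Fin n))ᶜ) := by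
  apply le_antisymm
  · rintro _ ⟨x, hx, rfl⟩
    rw [SetLike.mem_coe, mem_vanishingOn] at hx
    rw [Matrix.mulVecLin_apply, Matrix.mulVec_eq_sum]
    refine Submodule.sum_mem _ fun j _ => ?_
    by_cases hj : j ∈ I
    · simp [hx j hj]
    · rw [op_smul_eq_smul]
      exact Submodule.smul_mem _ _ (Submodule.subset_span ⟨j, hj, rfl⟩)
  · rw [Submodule.span_le]
    rintro _ ⟨j, hj, rfl⟩
    refine ⟨Pi.single j 1, mem_vanishingOn.2 fun i hi => ?_, ?_⟩
    · exact Pi.single_eq_of_ne (ne_of_mem_of_not_mem hi hj) _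
    · rw [Matrix.mulVecLin_apply, Matrix.mulVec_single_one]
      rfl

theorem finrank_map_add_finrank_inf_ker {F V W : Type*} [Field F] [AddCommGroup V] [Module F V]
    [FiniteDimensional F V] [AddCommGroup W] [Module F W] (f : V →ₗ[F] W) (p : Submodule F V) :
    Module.finrank F (p.map f) + Module.finrank F (p ⊓ LinearMap.ker f : Submodule F V) =
      Module.finrank F p := by
  rw [← (f.domRestrict p).finrank_range_add_finrank_ker, LinearMap.range_domRestrict,
    LinearMap.ker_domRestrict, ← Submodule.map_comap_subtype, Submodule.finrank_map_subtype_eq]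

theorem solutions_inter_Hset_nonempty_iff {F : Type*} [Field F] {n m : ℕ}
    (A : Matrix (Fin m) (Fin n) F) (b : Fin m → F) (I : Finset (Fin n)) :
    ({x | A.mulVec x = b} ∩ Hset F n I).Nonempty ↔
      b ∈ Submodule.span F ((fun j i => A i j) '' (I : Set (Fin n))ᶜ) := by
  rw [← map_vanishingOn]
  constructor
  · rintro ⟨x, hx, hI⟩
    exact ⟨x, mem_vanishingOn.2 hI, hx⟩
  · rintro ⟨x, hI, hx⟩
    exact ⟨x, hx, mem_vanishingOn.1 hI⟩

theorem affDim_solutions_inter_Hset {F : Type*} [Field F] {n m : ℕ}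
    (A : Matrix (Fin m) (Fin n) F) (b : Fin m → F) (I : Finset (Fin n))
    (h : ({x | A.mulVec x = b} ∩ Hset F n I).Nonempty) :
    affDim F ({x | A.mulVec x = b} ∩ Hset F n I) =
      (n : ℤ) - I.card -
        Module.finrank F (Submodule.span F ((fun j i => A i j) '' (I : Set (Fin n))ᶜ)) := by
  rw [affDim, if_neg h.ne_empty]
  obtain ⟨x₀, hx₀, hI⟩ := h
  have hS : {x | A.mulVec x = b} ∩ Hset F n I =
      (AffineSubspace.mk' x₀ (vanishingOn F I ⊓ LinearMap.ker A.mulVecLin) :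
        Set (Fin n → F)) := by
    ext x
    have hx₀' : A.mulVec x₀ = b := hx₀
    have hI' : (∀ i ∈ I, x i - x₀ i = 0) ↔ ∀ i ∈ I, x i = 0 :=
      forall₂_congr fun i hi => by rw [hI i hi, sub_zero]
    simp [Hset, AffineSubspace.mem_mk', mem_vanishingOn, Matrix.mulVec_sub, hx₀', sub_eq_zero,
      and_comm] at hI' ⊢
    simp [hI']
  rw [hS, AffineSubspace.affineSpan_coe, AffineSubspace.direction_mk', ← map_vanishingOn]
  have h₁ := card_add_finrank_vanishingOn (F := F) I
  have h₂ := finrank_map_add_finrank_inf_ker A.mulVecLin (vanishingOn F I)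
  omega

theorem affDim_solutions_inter_Hset_le_iff {F : Type*} [Field F] {n m d : ℕ} (hmd : m + d = n)
    (A : Matrix (Fin m) (Fin n) F) (b : Fin m → F) {I : Finset (Fin n)} (hI : I.card ≤ d + 1) :
    affDim F ({x | A.mulVec x = b} ∩ Hset F n I) ≤ (d : ℤ) - I.card ↔
      (b ∈ Submodule.span F ((fun j i => A i j) '' (I : Set (Fin n))ᶜ) →
        Submodule.span F ((fun j i => A i j) '' (I : Set (Fin n))ᶜ) = ⊤) := by
  rw [← solutions_inter_Hset_nonempty_iff]
  by_cases h : ({x | A.mulVec x = b} ∩ Hset F n I).Nonempty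
  · rw [affDim_solutions_inter_Hset A b I h]
    simp only [h, true_imp_iff]
    constructor
    · intro hle
      refine Submodule.eq_top_of_finrank_eq (le_antisymm (Submodule.finrank_le _) ?_)
      rw [Module.finrank_fin_fun]
      omega
    · intro htop
      rw [htop, finrank_top, Module.finrank_fin_fun]
      omega
  · simp only [h, false_imp_iff, iff_true]
    rw [affDim, if_pos (Set.not_nonempty_iff_eq_empty.1 h)]
    omega

/-- The solution set of `A·x = b` (with `A` of maximal rank `m = n - d`) is in general position
among its translates iff `b` lies in no proper subspace of `F^m` spanned by a subset of the
columns of `A`. -/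
theorem genPosTranslates_iff_columns {F : Type*} [Field F] {n m d : ℕ} (hmd : m + d = n)
    (A : Matrix (Fin m) (Fin n) F) (b : Fin m → F) (hrank : A.rank = m) :
    InGenPosTranslates F {x | A.mulVec x = b} d ↔
      ∀ J : Set (Fin n), b ∈ Submodule.span F ((fun j i => A i j) '' J) →
        Submodule.span F ((fun j i => A i j) '' J) = ⊤ := by
  have key : InGenPosTranslates F {x | A.mulVec x = b} d ↔ ∀ I : Finset (Fin n), I.card ≤ d + 1 →
      (b ∈ Submodule.span F ((fun j i => A i j) '' (I : Set (Fin n))ᶜ) →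
        Submodule.span F ((fun j i => A i j) '' (I : Set (Fin n))ᶜ) = ⊤) :=
    forall₂_congr fun I hI => affDim_solutions_inter_Hset_le_iff hmd A b hI
  rw [key]
  refine ⟨fun h J hb => ?_, fun h I _ => h _⟩
  obtain ⟨I, hIJ⟩ : ∃ I : Finset (Fin n), (I : Set (Fin n)) = Jᶜ := ⟨Jᶜ.toFinset, by simp⟩
  obtain rfl : J = (I : Set (Fin n))ᶜ := by rw [hIJ, compl_compl]
  by_cases hI : I.card ≤ d + 1
  · exact h I hI hb
  -- Adding columns until there are `m - 1` of them would give fewer than `m` spanning vectors.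
  obtain ⟨K, hKI, hK⟩ := Finset.exists_subset_card_eq (not_le.1 hI).le
  have htop := h K hK.le (Submodule.span_mono
    (Set.image_mono (Set.compl_subset_compl.2 (Finset.coe_subset.2 hKI))) hb)
  have hle := finrank_span_finset_le_card (R := F) (Kᶜ.image fun j i => A i j)
  have hcard := (Finset.card_image_le (s := Kᶜ) (f := fun j i => A i j))
  rw [Finset.coe_image, Finset.coe_compl, Set.finrank, htop, finrank_top,
    Module.finrank_fin_fun] at hle
  rw [Finset.card_compl, Fintype.card_fin] at hcard
  have hIn := card_finset_fin_le I
  omega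
end

section
/- Let F be a field, let (a_1,…,a_n) ∈ F^n be a nonzero vector, let b ∈ F, and let L = {x ∈ F^n : a_1x_1 + ⋯ + a_nx_n = b}, an (n−1)-dimensional affine subspace. Then: (i) L is in general position among its translates if and only if b ≠ 0; (ii) L is in general position if and only if b ≠ 0 and a_i ≠ 0 for all i. -/
open scoped Classical

/-- The linear map recording the value of the form `∑ aᵢxᵢ` and the coordinates indexed by `I`. -/
def formProdRestrict {F : Type*} [Field F] {n : ℕ} (a : Fin n → F) (I : Finset (Fin n)) :
    (Fin n → F) →ₗ[F] F × (I → F) :=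
  (∑ i, a i • LinearMap.proj i).prod (LinearMap.pi fun i : I => LinearMap.proj i.1)

theorem formProdRestrict_apply {F : Type*} [Field F] {n : ℕ} (a : Fin n → F)
    (I : Finset (Fin n)) (x : Fin n → F) :
    formProdRestrict a I x = (∑ i, a i * x i, fun i : I => x i) := by
  ext <;> simp [formProdRestrict]

theorem formProdRestrict_surjective {F : Type*} [Field F] {n : ℕ} (a : Fin n → F)
    (I : Finset (Fin n)) {j : Fin n} (hj : j ∉ I) (haj : a j ≠ 0) :
    Function.Surjective (formProdRestrict a I) := by
  rintro ⟨c, g⟩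
  let y : Fin n → F := fun i => if h : i ∈ I then g ⟨i, h⟩ else 0
  refine ⟨y + Pi.single j ((c - ∑ i, a i * y i) / a j), ?_⟩
  rw [formProdRestrict_apply]
  refine Prod.ext ?_ (funext fun i => ?_)
  · simp only [Pi.add_apply, mul_add, Finset.sum_add_distrib]
    rw [Fintype.sum_eq_single (f := fun i => a i * Pi.single (M := fun _ => F) j _ i) j]
    · rw [Pi.single_eq_same, mul_div_cancel₀ _ haj]
      ring
    · intro i hij
      simp [hij]
  · have hij : i.1 ≠ j := fun h => hj (h ▸ i.2)
    simp [y, hij]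

/-- If some `aⱼ ≠ 0` with `j ∉ I`, the hyperplane meets `H_I` in dimension `n - 1 - |I|`. -/
theorem affDim_hyperplane_inter_Hset {F : Type*} [Field F] {n : ℕ} (a : Fin n → F) (b : F)
    (I : Finset (Fin n)) {j : Fin n} (hj : j ∉ I) (haj : a j ≠ 0) :
    affDim F ({x : Fin n → F | ∑ i, a i * x i = b} ∩ Hset F n I) = (n : ℤ) - 1 - I.card := by
  have hsurj := formProdRestrict_surjective a I hj haj
  obtain ⟨x₀, hx₀⟩ := hsurj (b, 0)
  have hset : {x : Fin n → F | ∑ i, a i * x i = b} ∩ Hset F n I =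
      (AffineSubspace.mk' x₀ (LinearMap.ker (formProdRestrict a I)) :
        Set (Fin n → F)) := by
    ext x
    rw [SetLike.mem_coe, AffineSubspace.mem_mk', vsub_eq_sub, LinearMap.mem_ker, map_sub, hx₀,
      sub_eq_zero, formProdRestrict_apply, Prod.mk_inj, funext_iff]
    simp [Hset]
  have hne : (AffineSubspace.mk' x₀ (LinearMap.ker (formProdRestrict a I)) :
      Set (Fin n → F)) ≠ ∅ :=
    Set.Nonempty.ne_empty ⟨x₀, AffineSubspace.self_mem_mk' _ _⟩
  rw [hset, affDim, if_neg hne, AffineSubspace.affineSpan_coe, AffineSubspace.direction_mk']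
  have hrank := (formProdRestrict a I).finrank_range_add_finrank_ker
  rw [LinearMap.range_eq_top.2 hsurj, finrank_top] at hrank
  simp only [Module.finrank_prod, Module.finrank_self, Module.finrank_fintype_fun_eq_card,
    Fintype.card_coe, Fintype.card_fin] at hrank
  omega

/-- If every `aⱼ` with `j ∉ I` vanishes and `b ≠ 0`, the hyperplane does not meet `H_I`. -/
theorem affDim_hyperplane_inter_Hset_of_forall_eq_zero {F : Type*} [Field F] {n : ℕ}
    (a : Fin n → F) {b : F} (hb : b ≠ 0) (I : Finset (Fin n)) (hI : ∀ j ∉ I, a j = 0) :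
    affDim F ({x : Fin n → F | ∑ i, a i * x i = b} ∩ Hset F n I) = -1 := by
  refine if_pos (Set.eq_empty_of_forall_notMem ?_)
  rintro x ⟨hx, hxI⟩
  refine hb (hx.symm.trans (Finset.sum_eq_zero fun i _ => ?_))
  by_cases hi : i ∈ I
  · rw [hxI i hi, mul_zero]
  · rw [hI i hi, zero_mul]

theorem affDim_nonneg {F : Type*} [Field F] {n : ℕ} {S : Set (Fin n → F)} (hS : S.Nonempty) :
    0 ≤ affDim F S := by
  rw [affDim, if_neg hS.ne_empty]
  exact Int.natCast_nonneg _

theorem InGenPos.inGenPosTranslates {F : Type*} [Field F] {n : ℕ} {L : Set (Fin n → F)} {d : ℕ}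
    (h : InGenPos F L d) : InGenPosTranslates F L d :=
  fun I hI => (h I hI).le

/-- For a hyperplane `L = {x | Σ aᵢxᵢ = b}` (with `(a₁,…,aₙ) ≠ 0`, so `dim L = n-1`):
(i) `L` is in general position among its translates iff `b ≠ 0`;
(ii) `L` is in general position iff `b ≠ 0` and all `aᵢ ≠ 0`. -/
theorem hyperplane_genPos_iff {F : Type*} [Field F] {n : ℕ} (a : Fin n → F) (ha : a ≠ 0)
    (b : F) :
    (InGenPosTranslates F {x : Fin n → F | ∑ i, a i * x i = b} (n - 1) ↔ b ≠ 0) ∧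
    (InGenPos F {x : Fin n → F | ∑ i, a i * x i = b} (n - 1) ↔
      (b ≠ 0 ∧ ∀ i, a i ≠ 0)) := by
  obtain ⟨j₀, hj₀⟩ := Function.ne_iff.1 ha
  have hn : 0 < n := j₀.pos
  have htranslates :
      InGenPosTranslates F {x : Fin n → F | ∑ i, a i * x i = b} (n - 1) ↔ b ≠ 0 := by
    constructor
    · rintro h rfl
      have hle := h Finset.univ (by rw [Finset.card_univ, Fintype.card_fin]; omega)
      have hnonneg : 0 ≤ affDim F ({x : Fin n → F | ∑ i, a i * x i = 0} ∩
          Hset F n Finset.univ) := affDim_nonneg ⟨0, by simp [Hset]⟩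
      rw [Finset.card_univ, Fintype.card_fin] at hle
      omega
    · intro hb I hI
      by_cases h : ∃ j ∉ I, a j ≠ 0
      · obtain ⟨j, hj, haj⟩ := h
        rw [affDim_hyperplane_inter_Hset a b I hj haj]
        omega
      · push Not at h
        rw [affDim_hyperplane_inter_Hset_of_forall_eq_zero a hb I h]
        omega
  refine ⟨htranslates, fun h => ?_, fun ⟨hb, h⟩ I hI => ?_⟩
  · have hb := htranslates.1 h.inGenPosTranslates
    refine ⟨hb, fun i hi => ?_⟩
    have hcard : (Finset.univ.erase i).card = n - 1 := by simp
    have heq := h (Finset.univ.erase i) (by omega)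
    rw [affDim_hyperplane_inter_Hset_of_forall_eq_zero a hb _ (by simpa using hi)] at heq
    omega
  · by_cases hex : ∃ j, j ∉ I
    · obtain ⟨j, hj⟩ := hex
      rw [affDim_hyperplane_inter_Hset a b I hj (h j)]
      omega
    · push Not at hex
      have hcard : I.card = n := by
        rw [Finset.eq_univ_iff_forall.2 hex, Finset.card_univ, Fintype.card_fin]
      rw [affDim_hyperplane_inter_Hset_of_forall_eq_zero a hb I fun j hj => (hj (hex j)).elim]
      omega
end

section
/- Let F be an algebraically closed field, n ≥ 2, and let L ⊆ F^n be a 1-dimensional affine subspace (a line). Then L is in general position among its translates if and only if every point of L has at most one coordinate equal to 0. -/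
open scoped Classical

theorem affDim_empty (F : Type*) [Field F] {n : ℕ} : affDim F (∅ : Set (Fin n → F)) = -1 := by
  simp [affDim]

theorem affDim_le_zero_of_subsingleton {F : Type*} [Field F] {n : ℕ} {S : Set (Fin n → F)}
    (hS : S.Subsingleton) : affDim F S ≤ 0 := by
  unfold affDim
  split_ifs
  · norm_num
  · simp [direction_affineSpan, vectorSpan_of_subsingleton F hS]

/-- If two distinct points of an affine subspace lie in the hyperplane `x i = 0`, then some point
of the subspace has a second vanishing coordinate. -/
theorem AffineSubspace.exists_mem_two_coords_eq_zero {F : Type*} [Field F] {n : ℕ}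
    (W : AffineSubspace F (Fin n → F)) {p q : Fin n → F} (hp : p ∈ W) (hq : q ∈ W) (hpq : p ≠ q)
    {i : Fin n} (hpi : p i = 0) (hqi : q i = 0) :
    ∃ x ∈ W, ∃ j, x i = 0 ∧ x j = 0 ∧ i ≠ j := by
  obtain ⟨j, hj⟩ := Function.ne_iff.mp hpq
  have hj' : p j - q j ≠ 0 := sub_ne_zero.mpr hj
  refine ⟨AffineMap.lineMap p q (p j / (p j - q j)), AffineMap.lineMap_mem _ hp hq, j, ?_, ?_, ?_⟩
  · simp [AffineMap.lineMap_apply, hpi, hqi]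
  · simp only [AffineMap.lineMap_apply, vsub_eq_sub, vadd_eq_add, Pi.add_apply, Pi.smul_apply,
      Pi.sub_apply, smul_eq_mul]
    field_simp
    ring
  · rintro rfl
    exact hj (hpi.trans hqi.symm)

/-- Over an algebraically closed field, a line `L ⊆ F^n` (`n ≥ 2`) is in general position among
its translates iff every point of `L` has at most one coordinate equal to `0`. -/
theorem line_genPosTranslates_iff {F : Type*} [Field F] [IsAlgClosed F] {n : ℕ} (hn : 2 ≤ n)
    (L : Set (Fin n → F)) (hL : IsAffineOfDim F L 1) :
    InGenPosTranslates F L 1 ↔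
      ∀ x ∈ L, ∀ i j : Fin n, x i = 0 → x j = 0 → i = j := by
  obtain ⟨⟨W, rfl⟩, hne, hdim⟩ := hL
  constructor
  · intro h x hx i j hi hj
    by_contra hij
    have hcard : ({i, j} : Finset (Fin n)).card = 2 := Finset.card_pair hij
    have hle := h {i, j} hcard.le
    have hx' : x ∈ (W : Set (Fin n → F)) ∩ Hset F n {i, j} := ⟨hx, by simp [Hset, hi, hj]⟩
    have hnonneg := affDim_nonneg ⟨x, hx'⟩
    rw [hcard] at hle
    norm_num at hle
    omega
  · intro h I hI
    obtain h0 | h1 | h2 : I.card = 0 ∨ I.card = 1 ∨ I.card = 2 := by omega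
    · obtain rfl := Finset.card_eq_zero.mp h0
      have hH : Hset F n ∅ = Set.univ := by simp [Hset]
      rw [hH, Set.inter_univ, affDim, if_neg hne.ne_empty, hdim]
      simp
    · obtain ⟨i, rfl⟩ := Finset.card_eq_one.mp h1
      have hsub : ((W : Set (Fin n → F)) ∩ Hset F n {i}).Subsingleton := by
        rintro p ⟨hp, hpi⟩ q ⟨hq, hqi⟩
        by_contra hpq
        obtain ⟨x, hx, j, hxi, hxj, hij⟩ := W.exists_mem_two_coords_eq_zero hp hq hpq
          (hpi i (by simp)) (hqi i (by simp))
        exact hij (h x hx i j hxi hxj)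
      simpa using affDim_le_zero_of_subsingleton hsub
    · obtain ⟨i, j, hij, rfl⟩ := Finset.card_eq_two.mp h2
      have hempty : (W : Set (Fin n → F)) ∩ Hset F n {i, j} = ∅ :=
        Set.eq_empty_of_forall_notMem fun x ⟨hx, hxI⟩ =>
          hij (h x hx i j (hxI i (by simp)) (hxI j (by simp)))
      rw [hempty, affDim_empty, h2]
      norm_num
end

section
/- Let F be a field and let L ⊆ F^n be an affine subspace of dimension d with 0 ≤ d ≤ n − 1 that is in general position. Let ϖ : F^n → F^{n−1} be the projection (x_1,…,x_n) ↦ (x_1,…,x_{n−1}). Then ϖ restricted to L is injective (equivalently, the standard basis vector e_n does not lie in the direction of L), and ϖ(L) is a d-dimensional affine subspace of F^{n−1} that is in general position. -/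
open scoped Classical

theorem AffineSubspace.finrank_direction_affineSpan_image_of_injOn {F V V' : Type*} [Field F]
    [AddCommGroup V] [Module F V] [AddCommGroup V'] [Module F V'] (f : V →ₗ[F] V')
    (W : AffineSubspace F V) (hW : (W : Set V).Nonempty) (hf : Set.InjOn f W) {S : Set V}
    (hS : S ⊆ W) :
    Module.finrank F (affineSpan F (f '' S)).direction =
      Module.finrank F (affineSpan F S).direction := by
  obtain ⟨p, hp⟩ := hW
  have hmap : vectorSpan F (f '' S) = (vectorSpan F S).map f :=
    f.toAffineMap.map_vectorSpan.symm
  rw [direction_affineSpan, direction_affineSpan, hmap, ← LinearMap.range_domRestrict]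
  refine LinearMap.finrank_range_of_inj ((injective_iff_map_eq_zero _).2 ?_)
  rintro ⟨v, hv⟩ hfv
  have hvW : v ∈ W.direction := vectorSpan_mono F hS hv
  have hvp : v +ᵥ p = p := hf (W.vadd_mem_of_mem_direction hvW hp) hp
    (by simpa using hfv)
  simpa using hvp

theorem affDim_image_of_injOn {F : Type*} [Field F] {m n : ℕ}
    (f : (Fin m → F) →ₗ[F] (Fin n → F)) (W : AffineSubspace F (Fin m → F))
    (hW : (W : Set (Fin m → F)).Nonempty) (hf : Set.InjOn f W) {S : Set (Fin m → F)}
    (hS : S ⊆ W) : affDim F (f '' S) = affDim F S := by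
  unfold affDim
  rw [AffineSubspace.finrank_direction_affineSpan_image_of_injOn f W hW hf hS]
  simp only [Set.image_eq_empty]

theorem nonempty_and_subsingleton_of_affDim_eq_zero {F : Type*} [Field F] {n : ℕ}
    {S : Set (Fin n → F)} (h : affDim F S = 0) : S.Nonempty ∧ S.Subsingleton := by
  unfold affDim at h
  split_ifs at h with hS
  rw [Nat.cast_eq_zero, Submodule.finrank_eq_zero, direction_affineSpan,
    vectorSpan_eq_bot_iff_subsingleton] at h
  exact ⟨Set.nonempty_iff_ne_empty.2 hS, h⟩

theorem InGenPos.injOn_comp_castSucc {F : Type*} [Field F] {n d : ℕ} (hd : d ≤ n)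
    (W : AffineSubspace F (Fin (n + 1) → F)) (hW : InGenPos F (W : Set (Fin (n + 1) → F)) d) :
    Set.InjOn (fun x : Fin (n + 1) → F => x ∘ Fin.castSucc) W := by
  obtain ⟨J, -, hJ⟩ := Finset.exists_subset_card_eq
    (s := (Finset.univ : Finset (Fin n))) (n := d) (by simpa using hd)
  have hI : (J.map Fin.castSuccEmb).card = d := by simpa using hJ
  obtain ⟨⟨z, hzW, hzH⟩, hsub⟩ := nonempty_and_subsingleton_of_affDim_eq_zero
    ((hW _ (hI.trans_le d.le_succ)).trans (by rw [hI, sub_self]))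
  intro x hx y hy hxy
  have hmem : (x -ᵥ y) +ᵥ z ∈ (W : Set (Fin (n + 1) → F)) ∩
      Hset F (n + 1) (J.map Fin.castSuccEmb) := by
    refine ⟨W.vadd_mem_of_mem_direction (W.vsub_mem_direction hx hy) hzW, fun i hi => ?_⟩
    obtain ⟨j, -, rfl⟩ := Finset.mem_map.1 hi
    have hj : x j.castSucc = y j.castSucc := congrFun hxy j
    simpa [hj] using hzH _ hi
  have hz := hsub hmem ⟨hzW, hzH⟩
  simpa [sub_eq_zero] using hz

theorem image_comp_castSucc_inter_Hset {F : Type*} [Field F] {n : ℕ}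
    (L : Set (Fin (n + 1) → F)) (J : Finset (Fin n)) :
    (fun x : Fin (n + 1) → F => x ∘ Fin.castSucc) '' L ∩ Hset F n J =
      (fun x : Fin (n + 1) → F => x ∘ Fin.castSucc) ''
        (L ∩ Hset F (n + 1) (J.map Fin.castSuccEmb)) := by
  rw [← Set.image_inter_preimage]
  congr 2
  ext x
  simp [Hset]

/-- If `L ⊆ F^{n+1}` is a `d`-dimensional affine subspace in general position (`d ≤ n`), then
the projection onto the first `n` coordinates is injective on `L`, and its image is a
`d`-dimensional affine subspace of `F^n` in general position. -/
theorem genPos_projection {F : Type*} [Field F] {n d : ℕ} (hd : d ≤ n)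
    (L : Set (Fin (n + 1) → F)) (hL : IsAffineOfDim F L d)
    (hGP : InGenPos F L d) :
    Set.InjOn (fun x : Fin (n + 1) → F => x ∘ Fin.castSucc) L ∧
    IsAffineOfDim F ((fun x : Fin (n + 1) → F => x ∘ Fin.castSucc) '' L) d ∧
    InGenPos F ((fun x : Fin (n + 1) → F => x ∘ Fin.castSucc) '' L) d := by
  obtain ⟨⟨W, rfl⟩, hne, hdim⟩ := hL
  have hinj := hGP.injOn_comp_castSucc hd W
  let f : (Fin (n + 1) → F) →ₗ[F] (Fin n → F) := LinearMap.funLeft F F Fin.castSucc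
  refine ⟨hinj, ⟨⟨W.map f.toAffineMap, rfl⟩, hne.image _, ?_⟩, fun J hJ => ?_⟩
  · exact (AffineSubspace.finrank_direction_affineSpan_image_of_injOn f W hne hinj
      subset_rfl).trans hdim
  · rw [image_comp_castSucc_inter_Hset]
    refine (affDim_image_of_injOn f W hne hinj Set.inter_subset_left).trans ?_
    rw [hGP _ (by simpa using hJ), Finset.card_map]
end

section
/- Let F be an algebraically closed field and let L ⊆ F^n be an affine subspace of dimension d with 1 ≤ d ≤ n − 1 that is in general position. Then there is a finite subset Z ⊆ F such that for every t ∈ F \ Z, the slice L ∩ {x ∈ F^n : x_n = t}, regarded as a subset of F^{n−1} via the first n−1 coordinates, is a (d−1)-dimensional affine subspace of F^{n−1} in general position. -/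
open scoped Classical

open Module

/-- The dimension of a nonempty affine subspace is that of its direction. -/
theorem affDim_coe_of_mem {F : Type*} [Field F] {n : ℕ} {S : AffineSubspace F (Fin n → F)}
    {p : Fin n → F} (hp : p ∈ S) :
    affDim F (S : Set (Fin n → F)) = (finrank F S.direction : ℤ) := by
  have h : (S : Set (Fin n → F)) ≠ ∅ := Set.Nonempty.ne_empty ⟨p, hp⟩
  rw [affDim, if_neg h, AffineSubspace.affineSpan_coe]

theorem nonempty_of_affDim_nonneg {F : Type*} [Field F] {n : ℕ} {S : Set (Fin n → F)}
    (h : 0 ≤ affDim F S) : S.Nonempty := by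
  by_contra hS
  rw [Set.not_nonempty_iff_eq_empty] at hS
  simp [affDim, hS] at h

theorem subsingleton_of_affDim_eq_zero {F : Type*} [Field F] {n : ℕ} {S : Set (Fin n → F)}
    (h : affDim F S = 0) : S.Subsingleton := by
  have hS := nonempty_of_affDim_nonneg h.ge
  rw [affDim, if_neg hS.ne_empty, Nat.cast_eq_zero, Submodule.finrank_eq_zero,
    direction_affineSpan, vectorSpan_eq_bot_iff_subsingleton] at h
  exact h

theorem affDim_image_of_injective {F : Type*} [Field F] {m n : ℕ} (S : Set (Fin m → F))
    (g : (Fin m → F) →ᵃ[F] (Fin n → F)) (hg : Function.Injective g) :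
    affDim F (g '' S) = affDim F S := by
  unfold affDim
  simp only [Set.image_eq_empty]
  congr 2
  rw [← AffineSubspace.map_span, AffineSubspace.map_direction]
  exact (Submodule.equivMapOfInjective g.linear (g.linear_injective_iff.mpr hg) _).finrank_eq.symm

theorem inter_level_eq_mk' {F : Type*} [Field F] {n : ℕ} {S : AffineSubspace F (Fin n → F)}
    (f : (Fin n → F) →ₗ[F] F) {p : Fin n → F} (hp : p ∈ S) :
    (S : Set (Fin n → F)) ∩ {x | f x = f p} =
      AffineSubspace.mk' p (S.direction ⊓ LinearMap.ker f) := by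
  ext x
  simp only [Set.mem_inter_iff, SetLike.mem_coe, Set.mem_ofPred_eq, AffineSubspace.mem_mk',
    Submodule.mem_inf, LinearMap.mem_ker, AffineSubspace.vsub_right_mem_direction_iff_mem hp]
  simp [sub_eq_zero]

theorem affDim_inter_level {F : Type*} [Field F] {n : ℕ} {S : AffineSubspace F (Fin n → F)}
    (f : (Fin n → F) →ₗ[F] F) {p : Fin n → F} (hp : p ∈ S) :
    affDim F ((S : Set (Fin n → F)) ∩ {x | f x = f p}) =
      (finrank F ↥(S.direction ⊓ LinearMap.ker f) : ℤ) := by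
  rw [inter_level_eq_mk' f hp, affDim_coe_of_mem (AffineSubspace.self_mem_mk' _ _),
    AffineSubspace.direction_mk']

/-- If one nonempty level set of a linear form on an affine subspace has smaller dimension than
the subspace, then all level sets have the same dimension. -/
theorem affDim_inter_level_eq {F : Type*} [Field F] {n : ℕ} {S : AffineSubspace F (Fin n → F)}
    (f : (Fin n → F) →ₗ[F] F) {c : F}
    (h0 : 0 ≤ affDim F ((S : Set (Fin n → F)) ∩ {x | f x = c}))
    (hlt : affDim F ((S : Set (Fin n → F)) ∩ {x | f x = c}) < affDim F (S : Set (Fin n → F)))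
    (t : F) :
    affDim F ((S : Set (Fin n → F)) ∩ {x | f x = t}) =
      affDim F ((S : Set (Fin n → F)) ∩ {x | f x = c}) := by
  obtain ⟨p, hp, rfl⟩ := nonempty_of_affDim_nonneg h0
  rw [affDim_inter_level f hp] at hlt ⊢
  rw [affDim_coe_of_mem hp] at hlt
  obtain ⟨v, hv, hfv⟩ : ∃ v ∈ S.direction, f v ≠ 0 := by
    by_contra! hcon
    rw [inf_eq_left.mpr fun v hv => LinearMap.mem_ker.mpr (hcon v hv)] at hlt
    exact lt_irrefl _ hlt
  have hq : ((t - f p) / f v) • v +ᵥ p ∈ S :=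
    AffineSubspace.vadd_mem_of_mem_direction (S.direction.smul_mem _ hv) hp
  have hfq : f (((t - f p) / f v) • v +ᵥ p) = t := by
    simp [hfv]
  have := affDim_inter_level f hq
  rwa [hfq] at this

/-- The embedding of `F^n` into `F^{n+1}` as the hyperplane where the last coordinate is `t`. -/
def snocAffine (F : Type*) [Field F] (n : ℕ) (t : F) : (Fin n → F) →ᵃ[F] (Fin (n + 1) → F) where
  toFun y := Fin.snoc (α := fun _ => F) y t
  linear :=
    { toFun := fun y => Fin.snoc (α := fun _ => F) y 0
      map_add' := fun x y => by
        ext i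
        refine Fin.lastCases ?_ (fun j => ?_) i <;> simp
      map_smul' := fun c y => by
        ext i
        refine Fin.lastCases ?_ (fun j => ?_) i <;> simp }
  map_vadd' p v := by
    ext i
    refine Fin.lastCases ?_ (fun j => ?_) i <;> simp

theorem snocAffine_castSucc {F : Type*} [Field F] {n : ℕ} (t : F) (y : Fin n → F) (i : Fin n) :
    snocAffine F n t y i.castSucc = y i :=
  Fin.snoc_castSucc (α := fun _ => F) t y i

theorem snocAffine_last {F : Type*} [Field F] {n : ℕ} (t : F) (y : Fin n → F) :
    snocAffine F n t y (Fin.last n) = t :=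
  Fin.snoc_last (α := fun _ => F) t y

theorem snocAffine_injective {F : Type*} [Field F] {n : ℕ} (t : F) :
    Function.Injective (snocAffine F n t) := by
  intro x y h
  ext i
  rw [← snocAffine_castSucc t x i, h, snocAffine_castSucc]

theorem snocAffine_comp_castSucc {F : Type*} [Field F] {n : ℕ} {t : F} {x : Fin (n + 1) → F}
    (hx : x (Fin.last n) = t) : snocAffine F n t (x ∘ Fin.castSucc) = x := by
  ext i
  refine Fin.lastCases ?_ (fun j => ?_) i
  · rw [snocAffine_last, hx]
  · rw [snocAffine_castSucc, Function.comp_apply]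

theorem image_slice_eq_preimage {F : Type*} [Field F] {n : ℕ} (L : Set (Fin (n + 1) → F))
    (t : F) :
    (fun x : Fin (n + 1) → F => x ∘ Fin.castSucc) '' {x ∈ L | x (Fin.last n) = t} =
      snocAffine F n t ⁻¹' L := by
  ext y
  constructor
  · rintro ⟨x, ⟨hxL, hxt⟩, rfl⟩
    rwa [Set.mem_preimage, snocAffine_comp_castSucc hxt]
  · intro hy
    exact ⟨_, ⟨hy, snocAffine_last t y⟩, funext fun i => snocAffine_castSucc t y i⟩

theorem snocAffine_image_inter_Hset {F : Type*} [Field F] {n : ℕ} (L : Set (Fin (n + 1) → F))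
    (t : F) (I : Finset (Fin n)) :
    snocAffine F n t '' (snocAffine F n t ⁻¹' L ∩ Hset F n I) =
      (L ∩ Hset F (n + 1) (I.map Fin.castSuccEmb)) ∩ {x | x (Fin.last n) = t} := by
  ext x
  constructor
  · rintro ⟨y, ⟨hyL, hyI⟩, rfl⟩
    refine ⟨⟨hyL, fun i hi => ?_⟩, snocAffine_last t y⟩
    obtain ⟨j, hj, rfl⟩ := Finset.mem_map.mp hi
    exact (snocAffine_castSucc t y j).trans (hyI j hj)
  · rintro ⟨⟨hxL, hxI⟩, hxt⟩
    refine ⟨x ∘ Fin.castSucc, ⟨?_, fun i hi => ?_⟩, snocAffine_comp_castSucc hxt⟩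
    · rwa [Set.mem_preimage, snocAffine_comp_castSucc hxt]
    · exact hxI _ (Finset.mem_map_of_mem Fin.castSuccEmb hi)

theorem exists_affineSubspace_coe_eq_inter_Hset {F : Type*} [Field F] {n : ℕ}
    (W : AffineSubspace F (Fin n → F)) (I : Finset (Fin n)) :
    ∃ S : AffineSubspace F (Fin n → F),
      (S : Set (Fin n → F)) = (W : Set (Fin n → F)) ∩ Hset F n I := by
  refine ⟨W ⊓ (⨅ i ∈ I, LinearMap.ker (LinearMap.proj (R := F) (φ := fun _ => F) i)).toAffineSubspace, ?_⟩
  ext x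
  rw [SetLike.mem_coe, AffineSubspace.mem_inf_iff, Submodule.mem_toAffineSubspace]
  simp [Hset]

theorem last_notMem_map_castSuccEmb {n : ℕ} (I : Finset (Fin n)) :
    Fin.last n ∉ I.map Fin.castSuccEmb := by
  simp [Fin.castSucc_ne_last]

theorem Hset_insert {F : Type*} [Field F] {n : ℕ} (i : Fin n) (I : Finset (Fin n)) :
    Hset F n (insert i I) = Hset F n I ∩ {x | x i = 0} := by
  ext x
  simp [Hset, and_comm]

/-- A slice by `x_{n+1} = t` of an affine subspace in general position is in general position
as soon as it avoids the points of the subspace lying on `d` of the other coordinate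
hyperplanes. -/
theorem InGenPos.slice {F : Type*} [Field F] {n d : ℕ} (hd : 1 ≤ d)
    {W : AffineSubspace F (Fin (n + 1) → F)}
    (hGP : InGenPos F (W : Set (Fin (n + 1) → F)) d) {t : F}
    (ht : ∀ I : Finset (Fin n), I.card = d →
      ∀ x ∈ (W : Set (Fin (n + 1) → F)) ∩ Hset F (n + 1) (I.map Fin.castSuccEmb),
        x (Fin.last n) ≠ t) :
    InGenPos F (snocAffine F n t ⁻¹' (W : Set (Fin (n + 1) → F))) (d - 1) := by
  intro I hI
  rw [← affDim_image_of_injective _ _ (snocAffine_injective t), snocAffine_image_inter_Hset]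
  rcases (show I.card ≤ d by omega).eq_or_lt with hc | hc
  · have hempty : ((W : Set (Fin (n + 1) → F)) ∩ Hset F (n + 1) (I.map Fin.castSuccEmb)) ∩
        {x | x (Fin.last n) = t} = ∅ :=
      Set.eq_empty_of_forall_notMem fun x hx => ht I hc x hx.1 hx.2
    rw [hempty, affDim, if_pos rfl]
    omega
  · obtain ⟨S, hS⟩ := exists_affineSubspace_coe_eq_inter_Hset W (I.map Fin.castSuccEmb)
    have hdim := hGP (I.map Fin.castSuccEmb) (by rw [Finset.card_map]; omega)
    have hdim0 := hGP (insert (Fin.last n) (I.map Fin.castSuccEmb)) (by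
      rw [Finset.card_insert_of_notMem (last_notMem_map_castSuccEmb I), Finset.card_map]; omega)
    rw [Hset_insert, ← Set.inter_assoc,
      Finset.card_insert_of_notMem (last_notMem_map_castSuccEmb I)] at hdim0
    rw [← hS, Finset.card_map] at hdim hdim0
    rw [← hS]
    have key := affDim_inter_level_eq (S := S) (LinearMap.proj (Fin.last n)) (c := 0)
    simp only [LinearMap.proj_apply] at key
    rw [key (by rw [hdim0]; omega) (by rw [hdim0, hdim]; omega) t, hdim0]
    omega

theorem InGenPos.isAffineOfDim {F : Type*} [Field F] {n d : ℕ} {W : AffineSubspace F (Fin n → F)}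
    (hGP : InGenPos F (W : Set (Fin n → F)) d) : IsAffineOfDim F (W : Set (Fin n → F)) d := by
  have hdim := hGP ∅ (by simp)
  rw [show Hset F n ∅ = Set.univ by simp [Hset], Set.inter_univ, Finset.card_empty] at hdim
  have hne := nonempty_of_affDim_nonneg (show 0 ≤ affDim F (W : Set (Fin n → F)) by rw [hdim]; omega)
  refine ⟨⟨W, rfl⟩, hne, ?_⟩
  rw [affDim, if_neg hne.ne_empty] at hdim
  omega

/-- Over an algebraically closed field, if `L ⊆ F^{n+1}` is a `d`-dimensional affine subspace
in general position (`1 ≤ d ≤ n`), then for all but finitely many `t ∈ F`, the slice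
`L ∩ {x_{n+1} = t}`, viewed in `F^n` via the first `n` coordinates, is a `(d-1)`-dimensional
affine subspace in general position. -/
theorem genPos_slices {F : Type*} [Field F] [IsAlgClosed F] {n d : ℕ}
    (hd1 : 1 ≤ d) (hdn : d ≤ n)
    (L : Set (Fin (n + 1) → F)) (hL : IsAffineOfDim F L d)
    (hGP : InGenPos F L d) :
    ∃ Z : Finset F, ∀ t : F, t ∉ Z →
      IsAffineOfDim F
        ((fun x : Fin (n + 1) → F => x ∘ Fin.castSucc) ''
          {x ∈ L | x (Fin.last n) = t}) (d - 1) ∧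
      InGenPos F
        ((fun x : Fin (n + 1) → F => x ∘ Fin.castSucc) ''
          {x ∈ L | x (Fin.last n) = t}) (d - 1) := by
  obtain ⟨⟨W, rfl⟩, -⟩ := hL
  have hfin : (⋃ I ∈ {I : Finset (Fin n) | I.card = d}, (fun x => x (Fin.last n)) ''
      ((W : Set (Fin (n + 1) → F)) ∩ Hset F (n + 1) (I.map Fin.castSuccEmb))).Finite := by
    refine (Set.toFinite _).biUnion fun I hI => Set.Finite.image _ ?_
    refine (subsingleton_of_affDim_eq_zero ?_).finite
    rw [hGP _ (by rw [Finset.card_map, hI]; omega), Finset.card_map, hI, sub_self]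
  refine ⟨hfin.toFinset, fun t ht => ?_⟩
  rw [Set.Finite.mem_toFinset] at ht
  rw [image_slice_eq_preimage]
  have hslice := hGP.slice hd1 (t := t) fun I hI x hx hxt =>
    ht (Set.mem_biUnion hI ⟨x, hx, hxt⟩)
  rw [← AffineSubspace.coe_comap] at hslice ⊢
  exact ⟨hslice.isAffineOfDim, hslice⟩
end
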